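/- There is a universal constant C > 0 such that the following holds. Fix η, γ' ∈ (0,1/2] and an integer k ≥ 1 with γ' ≤ η k^{−3/2}. Then there exists a probability distribution Q on ℝ with all moments finite such that E_{x∼Q}[x^i] = E_{x∼P}[x^i] for every i = 1, 2, …, 2k, and Q assigns mass at least 1 − Cη to the single point −γ', i.e. Q({−γ'}) ≥ 1 − Cη. -/

import Mathlib

open MeasureTheory

/-- The exponential distribution with rate 1: the probability measure on `[0, ∞)`
with density `e^{-x}`. -/
noncomputable def expDist : Measure ℝ :=
  (volume.restrict (Set.Ici (0 : ℝ))).withDensity fun x => ENNReal.ofReal (Real.exp (-x))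

/-- The distribution `P` placing mass `1 - η` at the point `0` and mass `η` on the
exponential distribution with rate 1. -/
noncomputable def mixP (η : ℝ) : Measure ℝ :=
  ENNReal.ofReal (1 - η) • Measure.dirac (0 : ℝ) + ENNReal.ofReal η • expDist

open scoped Nat InnerProductSpace

lemma LinearMap.IsSymmetric.exists_inner_pow_apply_eq_sum {E : Type*} [NormedAddCommGroup E]
    [InnerProductSpace ℝ E] [FiniteDimensional ℝ E] {T : E →ₗ[ℝ] E} (hT : T.IsSymmetric) (v : E) :
    ∃ c t : Fin (Module.finrank ℝ E) → ℝ,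
      ∀ n : ℕ, ⟪v, (T ^ n) v⟫_ℝ = ∑ l, c l ^ 2 * t l ^ n := by
  let e := hT.eigenvectorBasis rfl
  refine ⟨fun l => ⟪v, e l⟫_ℝ, hT.eigenvalues rfl, fun n => ?_⟩
  have hpow : ∀ l, (T ^ n) (e l) = hT.eigenvalues rfl l ^ n • e l := fun l => by
    induction n with
    | zero => simp
    | succ n ih =>
      rw [pow_succ, Module.End.mul_apply, hT.apply_eigenvectorBasis, map_smul, ih, smul_smul,
        pow_succ, mul_comm]
      simp
  rw [← e.sum_inner_mul_inner]
  refine Finset.sum_congr rfl fun l _ => ?_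
  rw [← hT.pow n, hpow, real_inner_smul_left, real_inner_comm v (e l)]
  ring

/-- The truncated Hamburger moment problem with a positive definite Hankel matrix is solved by a
finitely supported measure. -/
lemma exists_sum_sq_mul_pow_eq_of_hankel_posDef {k : ℕ} {s : ℕ → ℝ}
    (hs : (Matrix.of fun i j : Fin (k + 1) => s (i + j)).PosDef) :
    ∃ (N : ℕ) (c t : Fin N → ℝ), ∀ n ≤ 2 * k, s n = ∑ l, c l ^ 2 * t l ^ n := by
  set H := Matrix.of fun i j : Fin (k + 1) => s (i + j) with hH
  open scoped MatrixOrder in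
  obtain ⟨B, hB⟩ := CStarAlgebra.nonneg_iff_eq_star_mul_self.mp hs.posSemidef.nonneg
  rw [Matrix.star_eq_conjTranspose, Matrix.conjTranspose_eq_transpose_of_trivial] at hB
  have hBu : IsUnit B.det := by
    have := (Matrix.isUnit_iff_isUnit_det _).1 hs.isUnit
    rw [hB, Matrix.det_mul] at this
    exact isUnit_of_mul_isUnit_right this
  have hBtu : IsUnit B.transpose.det := by rwa [Matrix.det_transpose]
  let H' := Matrix.of fun i j : Fin (k + 1) => s (i + j + 1)
  let M := B.transpose⁻¹ * H' * B⁻¹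
  have hM : M.IsHermitian := by
    rw [Matrix.IsHermitian, Matrix.conjTranspose_eq_transpose_of_trivial]
    have : H'.transpose = H' := by ext i j; simp [H', add_comm]
    simp only [M, Matrix.transpose_mul, this, Matrix.transpose_nonsing_inv,
      Matrix.transpose_transpose, Matrix.mul_assoc]
  have hT := Matrix.isSymmetric_toEuclideanLin_iff.mpr hM
  let v : Fin (k + 1) → EuclideanSpace ℝ (Fin (k + 1)) := fun i => WithLp.toLp 2 (B.col i)
  have hinner : ∀ i j, ⟪v i, v j⟫_ℝ = s (i + j) := fun i j => by
    have : H i j = s (i + j) := rfl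
    rw [← this, hB]
    simp [v, PiLp.inner_apply, Matrix.mul_apply, mul_comm]
  have hstep : ∀ i : Fin k, M.toEuclideanLin (v i.castSucc) = v i.succ := fun i => by
    have h1 : B.col i.castSucc = B.mulVec (Pi.single i.castSucc 1) := by simp
    have h2 : H'.mulVec (Pi.single i.castSucc 1) = H.mulVec (Pi.single i.succ 1) := by
      ext j
      simp [H', H, add_assoc]
    apply (WithLp.ofLp_injective 2)
    simp only [v, Matrix.ofLp_toLpLin, Matrix.toLin'_apply]
    rw [h1, Matrix.mulVec_mulVec, Matrix.mul_assoc, Matrix.nonsing_inv_mul _ hBu, Matrix.mul_one,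
      ← Matrix.mulVec_mulVec, h2, Matrix.mulVec_mulVec, hB, ← Matrix.mul_assoc,
      Matrix.nonsing_inv_mul _ hBtu, Matrix.one_mul]
    simp
  have hpow : ∀ i : Fin (k + 1), (M.toEuclideanLin ^ (i : ℕ)) (v 0) = v i := fun i => by
    induction i using Fin.induction with
    | zero => simp
    | succ i ih =>
      rw [Fin.val_succ, pow_succ', Module.End.mul_apply, ← hstep, ← ih]
      rfl
  obtain ⟨c, t, hct⟩ := hT.exists_inner_pow_apply_eq_sum (v 0)
  refine ⟨_, c, t, fun n hn => ?_⟩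
  obtain ⟨i, j, rfl⟩ : ∃ i j : Fin (k + 1), (i : ℕ) + j = n :=
    ⟨⟨n / 2, by omega⟩, ⟨n - n / 2, by omega⟩, by simp; omega⟩
  rw [← hct, ← hinner, ← hpow i, ← hpow j, hT.pow, pow_add, Module.End.mul_apply]

lemma factorial_add_eq_sum_choose_mul_choose {i j k : ℕ} (hi : i ≤ k) :
    (i + j)! = i ! * j ! * ∑ l ∈ Finset.range (k + 1), i.choose l * j.choose l := by
  have h : (i + j).choose i = ∑ l ∈ Finset.range (k + 1), i.choose l * j.choose l := by
    rw [Nat.add_choose_eq, Finset.Nat.sum_antidiagonal_eq_sum_range_succ_mk,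
      ← Finset.sum_range_reflect]
    rw [← Finset.sum_subset (Finset.range_mono (Nat.succ_le_succ hi))]
    · refine Finset.sum_congr rfl fun l hl => ?_
      have hl : l ≤ i := by simpa [Nat.lt_succ_iff] using hl
      have h1 : i + 1 - 1 - l = i - l := by omega
      simp only [h1, Nat.choose_symm hl, Nat.sub_sub_self hl]
    · intro l _ hl
      rw [Nat.choose_eq_zero_of_lt (by simpa using hl), zero_mul]
  rw [← h, ← Nat.add_choose_mul_factorial_mul_factorial i j, Nat.choose_symm_add]
  ring

lemma sum_neg_one_pow_mul_choose_mul_choose {i j k : ℕ} (hj : j ≤ k) :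
    ∑ l ∈ Finset.range (k + 1), (-1 : ℝ) ^ (l + i) * l.choose i * j.choose l =
      if j = i then 1 else 0 := by
  rw [← Finset.sum_subset (Finset.range_mono (Nat.succ_le_succ hj))]
  · rcases lt_or_ge j i with hji | hij
    · rw [if_neg hji.ne]
      refine Finset.sum_eq_zero fun l hl => ?_
      have hl : l ≤ j := by simpa [Nat.lt_succ_iff] using hl
      rw [Nat.choose_eq_zero_of_lt (hl.trans_lt hji)]
      simp
    · obtain ⟨d, rfl⟩ := Nat.exists_eq_add_of_le hij
      rw [show (i + d).succ = i + (d + 1) by omega, Finset.sum_range_add, Finset.sum_eq_zero,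
        zero_add]
      · have h := Int.alternating_sum_range_choose (n := d)
        have h' : (∑ m ∈ Finset.range (d + 1), (-1 : ℝ) ^ m * d.choose m)
            = if d = 0 then 1 else 0 := by exact_mod_cast h
        have hsum : ∀ m ∈ Finset.range (d + 1),
            (-1 : ℝ) ^ (i + m + i) * (i + m).choose i * (i + d).choose (i + m)
              = (i + d).choose i * ((-1 : ℝ) ^ m * d.choose m) := fun m _ => by
          have := Nat.choose_mul (n := i + d) (k := i + m) (s := i) (by omega)
          rw [Nat.add_sub_cancel_left, Nat.add_sub_cancel_left] at this
          have : ((i + d).choose (i + m) : ℝ) * (i + m).choose i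
              = (i + d).choose i * d.choose m := by exact_mod_cast this
          rw [show i + m + i = 2 * i + m by ring, pow_add, pow_mul]
          norm_num
          linear_combination (-1) ^ m * this
        rw [Finset.sum_congr rfl hsum, ← Finset.mul_sum, h']
        rcases eq_or_ne d 0 with rfl | hd <;> simp [*]
      · intro l hl
        rw [Nat.choose_eq_zero_of_lt (Finset.mem_range.1 hl)]
        simp
  · intro l _ hl
    rw [Nat.choose_eq_zero_of_lt (n := j) (by simpa using hl)]
    simp

/-- The coordinates of `∑ i ≤ k, a i * x ^ i` in the orthonormal (up to sign) basis of Laguerre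
polynomials of `L²(e^{-x} dx)`. -/
noncomputable def laguerreCoord (k : ℕ) (a : ℕ → ℝ) (l : ℕ) : ℝ :=
  ∑ i ∈ Finset.range (k + 1), a i * i ! * i.choose l

lemma sum_sum_mul_factorial_add (k : ℕ) (a : ℕ → ℝ) :
    ∑ i ∈ Finset.range (k + 1), ∑ j ∈ Finset.range (k + 1), a i * a j * ((i + j)! : ℝ) =
      ∑ l ∈ Finset.range (k + 1), laguerreCoord k a l ^ 2 := by
  have h : ∀ i ∈ Finset.range (k + 1), ∀ j ∈ Finset.range (k + 1),
      a i * a j * ((i + j)! : ℝ) = ∑ l ∈ Finset.range (k + 1),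
        (a i * i ! * i.choose l) * (a j * j ! * j.choose l) := fun i hi j _ => by
    rw [factorial_add_eq_sum_choose_mul_choose (Nat.lt_succ_iff.1 (Finset.mem_range.1 hi))]
    push_cast
    rw [Finset.mul_sum, Finset.mul_sum]
    exact Finset.sum_congr rfl fun l _ => by ring
  rw [Finset.sum_congr rfl fun i hi => Finset.sum_congr rfl (h i hi)]
  simp_rw [sq, laguerreCoord, Finset.sum_mul_sum]
  conv_rhs => rw [Finset.sum_comm]
  refine Finset.sum_congr rfl fun i _ => ?_
  rw [Finset.sum_comm]

lemma sum_choose_mul_laguerreCoord {i k : ℕ} (hi : i ≤ k) (a : ℕ → ℝ) :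
    ∑ l ∈ Finset.range (k + 1), (-1) ^ (l + i) * l.choose i * laguerreCoord k a l =
      a i * i ! := by
  simp_rw [laguerreCoord, Finset.mul_sum]
  rw [Finset.sum_comm]
  have h : ∀ j ∈ Finset.range (k + 1), ∑ l ∈ Finset.range (k + 1),
      (-1 : ℝ) ^ (l + i) * l.choose i * (a j * j ! * j.choose l) =
        a j * j ! * if j = i then 1 else 0 := fun j hj => by
    rw [← sum_neg_one_pow_mul_choose_mul_choose (Nat.lt_succ_iff.1 (Finset.mem_range.1 hj)),
      Finset.mul_sum]
    exact Finset.sum_congr rfl fun l _ => by ring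
  rw [Finset.sum_congr rfl h]
  simp [Nat.lt_succ_iff.2 hi]

lemma sq_sum_mul_neg_pow_sub_le {k : ℕ} (hk : 1 ≤ k) {γ : ℝ} (hγ : 0 ≤ γ) (hkγ : k * γ ≤ 1 / 2)
    (a : ℕ → ℝ) :
    (∑ i ∈ Finset.range (k + 1), a i * (-γ) ^ i - a 0) ^ 2 ≤
      8 * (k ^ 3 * γ ^ 2) * ∑ l ∈ Finset.range (k + 1), laguerreCoord k a l ^ 2 := by
  let m : ℕ → ℝ := fun l => ∑ i ∈ Finset.range (k + 1), l.choose i * (γ ^ i / i !) - 1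
  have hm0 : ∀ l, 0 ≤ m l := fun l => by
    simp only [m, Finset.sum_range_succ']
    have : 0 ≤ ∑ i ∈ Finset.range k, (l.choose (i + 1) : ℝ) * (γ ^ (i + 1) / (i + 1)!) :=
      Finset.sum_nonneg fun i _ => by positivity
    simpa using this
  have hm : ∀ l ∈ Finset.range (k + 1), m l ^ 2 ≤ (2 * (k * γ)) ^ 2 := fun l hl => by
    refine pow_le_pow_left₀ (hm0 l) ?_ 2
    have h1 : m l + 1 ≤ Real.exp (k * γ) := by
      refine le_trans ?_ (Real.sum_le_exp_of_nonneg (x := k * γ) (by positivity) (k + 1))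
      simp only [m, sub_add_cancel]
      refine Finset.sum_le_sum fun i _ => ?_
      rw [mul_pow, mul_div_assoc]
      gcongr
      have : l ≤ k := Nat.lt_succ_iff.1 (Finset.mem_range.1 hl)
      exact_mod_cast (Nat.choose_le_pow l i).trans (Nat.pow_le_pow_left this i)
    have hx : 0 ≤ k * γ := by positivity
    have h2 := abs_le.1 (Real.abs_exp_sub_one_sub_id_le (x := k * γ)
      (by rw [abs_of_nonneg hx]; linarith))
    nlinarith [h2.2]
  have hdiff : ∑ i ∈ Finset.range (k + 1), a i * (-γ) ^ i - a 0 =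
      ∑ l ∈ Finset.range (k + 1), laguerreCoord k a l * ((-1) ^ l * m l) := by
    have ha0 := sum_choose_mul_laguerreCoord (Nat.zero_le k) a
    have ha : ∀ i ∈ Finset.range (k + 1), a i * (-γ) ^ i = ∑ l ∈ Finset.range (k + 1),
        laguerreCoord k a l * ((-1) ^ l * (l.choose i * (γ ^ i / i !))) := fun i hi => by
      have h := sum_choose_mul_laguerreCoord (Nat.lt_succ_iff.1 (Finset.mem_range.1 hi)) a
      rw [show a i * (-γ) ^ i = (a i * i !) * ((-γ) ^ i / i !) by field_simp, ← h, Finset.sum_mul]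
      refine Finset.sum_congr rfl fun l _ => ?_
      have h1 : (-1 : ℝ) ^ i * (-1) ^ i = 1 := by rw [← mul_pow]; norm_num
      rw [neg_pow γ, pow_add]
      linear_combination (-1) ^ l * l.choose i * laguerreCoord k a l * (γ ^ i / i !) * h1
    rw [Finset.sum_congr rfl ha, Finset.sum_comm]
    simp only [Nat.factorial_zero, Nat.cast_one, mul_one, add_zero, Nat.choose_zero_right] at ha0
    rw [← ha0, ← Finset.sum_sub_distrib]
    refine Finset.sum_congr rfl fun l _ => ?_
    rw [← Finset.mul_sum, ← Finset.mul_sum]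
    simp only [m]
    ring
  rw [hdiff]
  refine (Finset.sum_mul_sq_le_sq_mul_sq _ _ _).trans ?_
  rw [mul_comm]
  refine mul_le_mul_of_nonneg_right ?_ (Finset.sum_nonneg fun l _ => sq_nonneg _)
  calc ∑ l ∈ Finset.range (k + 1), ((-1) ^ l * m l) ^ 2
      = ∑ l ∈ Finset.range (k + 1), m l ^ 2 := Finset.sum_congr rfl fun l _ => by
        rw [mul_pow, ← pow_mul, mul_comm l, pow_mul]; norm_num
    _ ≤ (k + 1) * (2 * (k * γ)) ^ 2 := by
        simpa using Finset.sum_le_card_nsmul _ _ _ hm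
    _ ≤ 8 * (k ^ 3 * γ ^ 2) := by
        have : (1 : ℝ) ≤ k := by exact_mod_cast hk
        have h : 0 ≤ (k - 1 : ℝ) * (k * γ) ^ 2 := mul_nonneg (by linarith) (sq_nonneg _)
        nlinarith [h]

lemma integrable_pow_expDist (n : ℕ) : Integrable (fun x => x ^ n) expDist := by
  rw [expDist, integrable_withDensity_iff (by fun_prop) (by simp), ← IntegrableOn,
    integrableOn_Ici_iff_integrableOn_Ioi]
  refine (Real.GammaIntegral_convergent (s := n + 1) (by positivity)).congr_fun (fun x hx => ?_)
    measurableSet_Ioi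
  simp [(Real.exp_pos _).le, mul_comm]

lemma integral_pow_expDist (n : ℕ) : ∫ x, x ^ n ∂expDist = n ! := by
  rw [expDist, integral_withDensity_eq_integral_toReal_smul (by fun_prop) (by simp),
    integral_Ici_eq_integral_Ioi, ← Real.Gamma_nat_eq_factorial,
    Real.Gamma_eq_integral (by positivity)]
  refine setIntegral_congr_fun measurableSet_Ioi fun x _ => ?_
  simp [(Real.exp_pos _).le]

lemma integral_pow_mixP {η : ℝ} (h0 : 0 ≤ η) (h1 : η ≤ 1) (n : ℕ) :
    ∫ x, x ^ n ∂mixP η = (1 - η) * 0 ^ n + η * n ! := by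
  rw [mixP, integral_add_measure ((integrable_dirac (by simp)).smul_measure (by simp))
    ((integrable_pow_expDist n).smul_measure (by simp)), integral_smul_measure,
    integral_smul_measure, integral_dirac, integral_pow_expDist,
    ENNReal.toReal_ofReal h0, ENNReal.toReal_ofReal (by linarith), smul_eq_mul, smul_eq_mul]

lemma hankel_posDef {η γ w : ℝ} {k : ℕ} (hη : 0 < η) (hη1 : η ≤ 1 / 2) (hγ : 0 ≤ γ) (hk : 1 ≤ k)
    (hγk : k ^ 3 * γ ^ 2 ≤ η ^ 2) (hw : w = max 0 (1 - 32 * η)) :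
    (Matrix.of fun i j : Fin (k + 1) =>
      (1 - η) * (0 : ℝ) ^ (i + j : ℕ) + η * (i + j : ℕ)! - w * (-γ) ^ (i + j : ℕ)).PosDef := by
  refine .of_dotProduct_mulVec_pos ?_ fun x hx => ?_
  · ext i j
    simp [add_comm (i : ℕ)]
  let a : ℕ → ℝ := fun n => if h : n < k + 1 then x ⟨n, h⟩ else 0
  have ha : ∀ i : Fin (k + 1), x i = a i := fun i => by simp only [a, i.2, dite_true, Fin.eta]
  set N := ∑ l ∈ Finset.range (k + 1), laguerreCoord k a l ^ 2 with hN
  set p := ∑ i ∈ Finset.range (k + 1), a i * (-γ) ^ i with hp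
  have hkγ : k * γ ≤ 1 / 2 := by
    have hk' : (1 : ℝ) ≤ k := by exact_mod_cast hk
    have h : 0 ≤ (k - 1 : ℝ) * (k * γ) ^ 2 := mul_nonneg (by linarith) (sq_nonneg _)
    refine le_of_sq_le_sq ?_ (by norm_num)
    nlinarith
  have hd : (p - a 0) ^ 2 ≤ 8 * η ^ 2 * N := by
    refine (sq_sum_mul_neg_pow_sub_le hk hγ hkγ a).trans ?_
    exact mul_le_mul_of_nonneg_right (by linarith) (Finset.sum_nonneg fun l _ => sq_nonneg _)
  have hNpos : 0 < N := by
    refine (Finset.sum_nonneg fun l _ => sq_nonneg _).lt_of_ne' fun h0 => hx ?_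
    have hc := (Finset.sum_eq_zero_iff_of_nonneg fun l _ => sq_nonneg _).1 h0
    ext i
    have h := sum_choose_mul_laguerreCoord (Nat.lt_succ_iff.1 i.2) a
    rw [Finset.sum_eq_zero fun l hl => by simp [pow_eq_zero_iff two_ne_zero |>.1 (hc l hl)]] at h
    rw [ha, Pi.zero_apply]
    exact (mul_eq_zero.1 h.symm).resolve_right (by positivity)
  have hform : star x ⬝ᵥ ((Matrix.of fun i j : Fin (k + 1) => (1 - η) * (0 : ℝ) ^ (i + j : ℕ) +
      η * (i + j : ℕ)! - w * (-γ) ^ (i + j : ℕ)).mulVec x) =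
      (1 - η) * a 0 ^ 2 + η * N - w * p ^ 2 := by
    have h0 : a 0 = ∑ i ∈ Finset.range (k + 1), a i * 0 ^ i := by
      simp [Finset.sum_range_succ']
    rw [hN, ← sum_sum_mul_factorial_add, h0, hp, sq, sq, Finset.sum_mul_sum, Finset.sum_mul_sum]
    simp only [dotProduct, Matrix.mulVec, Matrix.of_apply, star_trivial, ha]
    simp only [Finset.mul_sum]
    rw [Fin.sum_univ_eq_sum_range (fun i => ∑ j : Fin (k + 1), a i * (((1 - η) * (0 : ℝ) ^ (i + j) +
      η * (i + j)! - w * (-γ) ^ (i + j)) * a j))]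
    simp only [← Finset.sum_add_distrib, ← Finset.sum_sub_distrib]
    refine Finset.sum_congr rfl fun i _ => ?_
    rw [Fin.sum_univ_eq_sum_range (fun j => a i * (((1 - η) * (0 : ℝ) ^ (i + j) +
      η * (i + j)! - w * (-γ) ^ (i + j)) * a j))]
    refine Finset.sum_congr rfl fun j _ => ?_
    ring
  rw [hform]
  rcases le_total (1 - 32 * η) 0 with h | h
  · rw [hw, max_eq_left h]
    nlinarith [sq_nonneg (a 0), mul_pos hη hNpos]
  · rw [hw, max_eq_right h]
    have hp2 : p ^ 2 ≤ (1 + 31 * η) * a 0 ^ 2 + (8 * η ^ 2 + 8 / 31 * η) * N := by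
      have h1 : 2 * (a 0 * (p - a 0)) ≤ 31 * η * a 0 ^ 2 + 8 / 31 * η * N := by
        have h2 : (p - a 0) ^ 2 / (31 * η) ≤ 8 / 31 * η * N := by
          rw [div_le_iff₀ (by positivity)]
          linarith
        have h3 : 31 * η * a 0 ^ 2 + (p - a 0) ^ 2 / (31 * η) - 2 * (a 0 * (p - a 0)) =
            (31 * η * a 0 - (p - a 0)) ^ 2 / (31 * η) := by field_simp; ring
        have h4 : 0 ≤ (31 * η * a 0 - (p - a 0)) ^ 2 / (31 * η) := by positivity
        linarith
      linarith [show p ^ 2 = a 0 ^ 2 + 2 * (a 0 * (p - a 0)) + (p - a 0) ^ 2 by ring]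
    have hmul := mul_le_mul_of_nonneg_left hp2 h
    have hA : (1 - 32 * η) * ((1 + 31 * η) * a 0 ^ 2) ≤ (1 - η) * a 0 ^ 2 := by
      rw [← mul_assoc]
      exact mul_le_mul_of_nonneg_right (by nlinarith) (sq_nonneg _)
    have hB : (1 - 32 * η) * ((8 * η ^ 2 + 8 / 31 * η) * N) < η * N := by
      rw [← mul_assoc]
      refine mul_lt_mul_of_pos_right ?_ hNpos
      have : (1 - 32 * η) * (8 * η + 8 / 31) < 1 := by nlinarith
      nlinarith
    linarith

/-- There is a universal constant `C > 0` such that for all `η, γ' ∈ (0,1/2]` and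
integers `k ≥ 1` with `γ' ≤ η k^{-3/2}`, there exists a probability distribution `Q`
on `ℝ` with all moments finite, matching the first `2k` moments of `P`, and assigning
mass at least `1 - Cη` to the single point `-γ'`. -/
theorem moment_matching_distribution :
    ∃ C : ℝ, 0 < C ∧
      ∀ (η γ' : ℝ) (k : ℕ), 0 < η → η ≤ 1 / 2 → 0 < γ' → γ' ≤ 1 / 2 → 1 ≤ k →
        γ' ≤ η * (k : ℝ) ^ (-(3 : ℝ) / 2) →
        ∃ Q : Measure ℝ, IsProbabilityMeasure Q ∧
          (∀ i : ℕ, Integrable (fun x => x ^ i) Q) ∧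
          (∀ i ∈ Finset.Icc 1 (2 * k), ∫ x, x ^ i ∂Q = ∫ x, x ^ i ∂(mixP η)) ∧
          1 - C * η ≤ (Q {-γ'}).toReal := by
  refine ⟨32, by norm_num, fun η γ k hη hη1 hγ _ hk hγk => ?_⟩
  have hγk' : k ^ 3 * γ ^ 2 ≤ η ^ 2 := by
    have hk0 : (0 : ℝ) < k := by exact_mod_cast hk
    have h := pow_le_pow_left₀ hγ.le hγk 2
    rw [mul_pow, ← Real.rpow_mul_natCast hk0.le] at h
    norm_num [Real.rpow_neg hk0.le] at h
    rw [← div_eq_mul_inv, le_div_iff₀ (by positivity)] at h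
    linarith
  obtain ⟨N, c, t, hct⟩ := exists_sum_sq_mul_pow_eq_of_hankel_posDef
    (s := fun n => (1 - η) * (0 : ℝ) ^ n + η * (n ! : ℝ) - max 0 (1 - 32 * η) * (-γ) ^ n)
    (hankel_posDef hη hη1 hγ.le hk hγk' rfl)
  set w := max 0 (1 - 32 * η) with hw
  have hw0 : 0 ≤ w := le_max_left _ _
  let R : Measure ℝ := ∑ l, ENNReal.ofReal (c l ^ 2) • Measure.dirac (t l)
  let Q : Measure ℝ := ENNReal.ofReal w • Measure.dirac (-γ) + R
  have hR : ∀ l ∈ Finset.univ, ∀ n : ℕ,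
      Integrable (fun x => x ^ n) (ENNReal.ofReal (c l ^ 2) • Measure.dirac (t l)) :=
    fun l _ n => (integrable_dirac (by simp)).smul_measure (by simp)
  have hQ₁ : ∀ n : ℕ, Integrable (fun x => x ^ n) (ENNReal.ofReal w • Measure.dirac (-γ)) :=
    fun n => (integrable_dirac (by simp)).smul_measure (by simp)
  have hQ₂ : ∀ n : ℕ, Integrable (fun x => x ^ n) R := fun n =>
    integrable_finsetSum_measure.2 fun l hl => hR l hl n
  have hQ : ∀ n ≤ 2 * k, ∫ x, x ^ n ∂Q = (1 - η) * 0 ^ n + η * n ! := fun n hn => by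
    rw [integral_add_measure (hQ₁ n) (hQ₂ n), integral_finsetSum_measure fun l hl => hR l hl n]
    simp only [integral_smul_measure, integral_dirac, smul_eq_mul, ENNReal.toReal_ofReal hw0,
      ENNReal.toReal_ofReal (sq_nonneg _)]
    rw [← hct n hn]
    ring
  refine ⟨Q, ⟨?_⟩, fun n => (hQ₁ n).add_measure (hQ₂ n), fun n hn => ?_, ?_⟩
  · have h := hQ 0 (Nat.zero_le _)
    simp only [pow_zero, integral_const, smul_eq_mul, mul_one, Nat.factorial_zero, Nat.cast_one,
      sub_add_cancel, measureReal_def] at h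
    exact (ENNReal.toReal_eq_one_iff _).1 h
  · rw [hQ n (Finset.mem_Icc.1 hn).2, integral_pow_mixP hη.le (by linarith)]
  · have : IsFiniteMeasure Q := (integrable_const_iff_isFiniteMeasure one_ne_zero).1
      (by simpa only [pow_zero] using (hQ₁ 0).add_measure (hQ₂ 0))
    have hle : ENNReal.ofReal w ≤ Q {-γ} := by
      simp [Q]
    exact (le_max_right _ _).trans ((ENNReal.ofReal_le_iff_le_toReal (measure_ne_top _ _)).1 hle)
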